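/- For all integers p, q ≥ 1 and signs σ1, σ2 ∈ {1,−1} with (q,σ2) ≠ (1,1), the linear Euler T-sum T_{p,q}^{σ1,σ2}, viewed as a complex number, satisfies T_{p,q}^{σ1,σ2} = 2^{p+q−2} · i^{3λ_{σ1}+3λ_{σ2}} · ( L_4(q,p; λ_{σ2}, λ_{σ1}) − L_4(q,p; λ_{σ2}, λ_{σ1}+2) − L_4(q,p; λ_{σ2}+2, λ_{σ1}) + L_4(q,p; λ_{σ2}+2, λ_{σ1}+2) ). -/

import Mathlib

open scoped BigOperators

/-- Alternating odd harmonic number `h_n^{(p)}(σ) = ∑_{k=1}^n σ^{k-1}/(k-1/2)^p`. -/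
noncomputable def oddH (n p : ℕ) (σ : ℝ) : ℝ :=
  ∑ k ∈ Finset.range n, σ ^ k / ((k : ℝ) + 1 / 2) ^ p

/-- Linear Euler T-sum `T_{p,q}^{σ1,σ2} = ∑_{n≥1} σ2^{n-1} h_{n-1}^{(p)}(σ1)/(n-1/2)^q`. -/
noncomputable def TSum (p q : ℕ) (σ1 σ2 : ℝ) : ℝ :=
  ∑' n : ℕ, σ2 ^ n * oddH n p σ1 / ((n : ℝ) + 1 / 2) ^ q

/-- Depth-two colored multiple zeta value of level four
`L_4(s1,s2;r1,r2) = ∑_{n1>n2≥1} i^{r1 n1 + r2 n2}/(n1^{s1} n2^{s2})`. -/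
noncomputable def L4 (s1 s2 : ℕ) (r1 r2 : ℕ) : ℂ :=
  ∑' x : {p : ℕ × ℕ // 0 < p.2 ∧ p.2 < p.1},
    Complex.I ^ (r1 * x.1.1 + r2 * x.1.2) / ((x.1.1 : ℂ) ^ s1 * (x.1.2 : ℂ) ^ s2)

/-- `λ_σ = 0` if `σ = 1`, and `λ_σ = 1` if `σ = -1`. -/
noncomputable def lam (σ : ℝ) : ℕ := if σ = 1 then 0 else 1

open Complex in
theorem aux_norm (q p r1 r2 : ℕ) (a b : ℕ) :
    ‖Complex.I ^ (r1 * a + r2 * b) / ((a : ℂ) ^ q * (b : ℂ) ^ p)‖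
      = 1 / ((a : ℝ) ^ q * (b : ℝ) ^ p) := by
  simp

theorem aux_summable (q p r1 r2 : ℕ) (hq : 2 ≤ q) (hp : 1 ≤ p) :
    Summable (fun x : {p : ℕ × ℕ // 0 < p.2 ∧ p.2 < p.1} =>
      Complex.I ^ (r1 * x.1.1 + r2 * x.1.2) / ((x.1.1 : ℂ) ^ q * (x.1.2 : ℂ) ^ p)) := by
  have h0 : Summable (fun n : ℕ => 1 / (n : ℝ) ^ (3 / 2 : ℝ)) :=
    Real.summable_one_div_nat_rpow.mpr (by norm_num)
  have h1 := h0.mul_of_nonneg h0 (fun n => by positivity) (fun n => by positivity)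
  have h2 := h1.subtype {p : ℕ × ℕ | 0 < p.2 ∧ p.2 < p.1}
  refine Summable.of_norm_bounded h2 ?_
  rintro ⟨⟨a, b⟩, hb, hab⟩
  simp only at hb hab
  rw [aux_norm]
  simp only [Function.comp]
  rw [one_div_mul_one_div]
  have hb' : (1 : ℝ) ≤ b := by exact_mod_cast hb
  have hab' : (b : ℝ) ≤ a := by exact_mod_cast hab.le
  have ha' : (1 : ℝ) ≤ a := hb'.trans hab'
  apply one_div_le_one_div_of_le (by positivity)
  have e1 : (a : ℝ) ^ (3 / 2 : ℝ) * (b : ℝ) ^ (3 / 2 : ℝ)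
      ≤ (a : ℝ) ^ (3 / 2 : ℝ) * ((a : ℝ) ^ (1 / 2 : ℝ) * b) := by
    have : (b : ℝ) ^ (3 / 2 : ℝ) = (b : ℝ) ^ (1 / 2 : ℝ) * b := by
      rw [← Real.rpow_add_one (by positivity)]; norm_num
    rw [this]
    gcongr
  have e2 : (a : ℝ) ^ (3 / 2 : ℝ) * ((a : ℝ) ^ (1 / 2 : ℝ) * b) = (a : ℝ) ^ 2 * b ^ 1 := by
    rw [← mul_assoc, ← Real.rpow_add (by positivity), ← Real.rpow_natCast]; norm_num
  calc _ ≤ _ := e1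
    _ = _ := e2
    _ ≤ _ := by gcongr

theorem aux_L4_one (p r1 r2 : ℕ) : L4 1 p r1 r2 = 0 := by
  unfold L4
  apply tsum_eq_zero_of_not_summable
  intro h
  have h1 := h.norm
  let e : ℕ → {p : ℕ × ℕ // 0 < p.2 ∧ p.2 < p.1} := fun n => ⟨(n + 2, 1), by simp⟩
  have he : Function.Injective e := by
    intro a b hab
    simpa [e] using hab
  have h2 := h1.comp_injective he
  have h3 : Summable (fun n : ℕ => 1 / (n : ℝ)) := by
    rw [← summable_nat_add_iff 2]
    refine h2.congr ?_
    intro n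
    simp only [Function.comp, aux_norm]
    simp [e]
  exact Real.not_summable_one_div_natCast h3

theorem aux_oddH (p : ℕ) (hp : 1 ≤ p) (σ : ℝ) (h1 : σ = 1 ∨ σ = -1) :
    ∃ c : ℝ, 0 < c ∧ ∀ m : ℕ, c ≤ oddH (2 * m + 2) p σ := by
  have key : ∀ k : ℕ, 1 / ((k : ℝ) + 1 + 1 / 2) ^ p < 1 / ((k : ℝ) + 1 / 2) ^ p := by
    intro k
    apply one_div_lt_one_div_of_lt (by positivity)
    apply pow_lt_pow_left₀ (by linarith) (by positivity) (by omega)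
  have pos : ∀ k : ℕ, 0 < 1 / ((k : ℝ) + 1 + 1 / 2) ^ p := fun k => by positivity
  have pair : ∀ m : ℕ, 1 / (((2 * m : ℕ) : ℝ) + 1 / 2) ^ p - 1 / (((2 * m : ℕ) : ℝ) + 1 + 1 / 2) ^ p
      ≤ σ ^ (2 * m) / (((2 * m : ℕ) : ℝ) + 1 / 2) ^ p
        + σ ^ (2 * m + 1) / (((2 * m + 1 : ℕ) : ℝ) + 1 / 2) ^ p := by
    intro m
    have := pos (2 * m)
    rw [Nat.cast_add_one]
    rcases h1 with rfl | rfl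
    · simp only [one_pow]; linarith
    · simp only [pow_succ, pow_mul]
      norm_num
      apply le_of_eq; ring
  refine ⟨_, sub_pos.mpr (key 0), ?_⟩
  intro m
  induction m with
  | zero =>
    have := pair 0
    simp only [oddH, Finset.sum_range_succ, Finset.sum_range_zero]
    simpa using this
  | succ m ih =>
    have := pair (m + 1)
    have k := key (2 * (m + 1))
    have : oddH (2 * (m + 1) + 2) p σ = oddH (2 * m + 2) p σ +
      (σ ^ (2 * (m + 1)) / (((2 * (m + 1) : ℕ) : ℝ) + 1 / 2) ^ p
        + σ ^ (2 * (m + 1) + 1) / (((2 * (m + 1) + 1 : ℕ) : ℝ) + 1 / 2) ^ p) := by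
      simp only [oddH]
      rw [Finset.sum_range_succ, Finset.sum_range_succ, add_assoc]
      rfl
    linarith

theorem aux_TSum_one (p : ℕ) (hp : 1 ≤ p) (σ1 σ2 : ℝ)
    (h1 : σ1 = 1 ∨ σ1 = -1) (h2 : σ2 = 1 ∨ σ2 = -1) : TSum p 1 σ1 σ2 = 0 := by
  unfold TSum
  apply tsum_eq_zero_of_not_summable
  intro h
  obtain ⟨c, hc, hcm⟩ := aux_oddH p hp σ1 h1
  have he : Function.Injective (fun m : ℕ => 2 * m + 2) := by
    intro a b hab
    simp only at hab
    omega
  have h3 := h.norm.comp_injective he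
  have h4 : Summable (fun m : ℕ => (c / 3) * (1 / ((m + 1 : ℕ) : ℝ))) := by
    refine Summable.of_nonneg_of_le (fun m => by positivity) ?_ h3
    intro m
    have hs : |σ2| = 1 := by rcases h2 with rfl | rfl <;> simp
    simp only [Function.comp, pow_one, norm_div, norm_mul, norm_pow, Real.norm_eq_abs, hs, one_pow,
      one_mul]
    rw [abs_of_pos (hc.trans_le (hcm m)), abs_of_pos (by positivity), div_mul_div_comm, mul_one]
    apply div_le_div₀ (hc.le.trans (hcm m)) (hcm m) (by positivity)
    push_cast
    have : (0 : ℝ) ≤ m := by positivity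
    linarith
  rw [summable_mul_left_iff (by positivity), summable_nat_add_iff (f := fun n : ℕ => 1 / (n : ℝ)) 1] at h4
  exact Real.not_summable_one_div_natCast h4

theorem aux_I (σ : ℝ) (h : σ = 1 ∨ σ = -1) (a : ℕ) :
    Complex.I ^ (3 * lam σ) * Complex.I ^ (lam σ * (2 * a + 1)) = (σ : ℂ) ^ a := by
  rcases h with rfl | rfl
  · simp [lam]
  · have : lam (-1) = 1 := by unfold lam; norm_num
    rw [this, ← pow_add, show 3 * 1 + 1 * (2 * a + 1) = 2 * (a + 2) by ring, pow_mul, Complex.I_sq,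
      pow_add]
    simp

theorem aux_odd (a : ℕ) : Complex.I ^ (2 * a) = (-1) ^ a := by
  rw [pow_mul, Complex.I_sq]

theorem aux_main (p q : ℕ) (hp : 1 ≤ p) (hq : 2 ≤ q) (σ1 σ2 : ℝ)
    (h1 : σ1 = 1 ∨ σ1 = -1) (h2 : σ2 = 1 ∨ σ2 = -1) :
    (TSum p q σ1 σ2 : ℂ) =
      2 ^ (p + q - 2) * Complex.I ^ (3 * lam σ1 + 3 * lam σ2) *
        (L4 q p (lam σ2) (lam σ1) - L4 q p (lam σ2) (lam σ1 + 2)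
          - L4 q p (lam σ2 + 2) (lam σ1) + L4 q p (lam σ2 + 2) (lam σ1 + 2)) := by
  have S := fun r1 r2 => (aux_summable q p r1 r2 hq hp).hasSum
  set C : ℂ := 2 ^ (p + q - 2) * Complex.I ^ (3 * lam σ1 + 3 * lam σ2) with hC
  let s : Set (ℕ × ℕ) := {p : ℕ × ℕ | 0 < p.2 ∧ p.2 < p.1}
  let G : ℕ × ℕ → ℂ := fun x => C * (Complex.I ^ (lam σ2 * x.1 + lam σ1 * x.2)
    * (1 - (-1) ^ x.1) * (1 - (-1) ^ x.2) / ((x.1 : ℂ) ^ q * (x.2 : ℂ) ^ p))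
  have H := ((((S (lam σ2) (lam σ1)).sub (S (lam σ2) (lam σ1 + 2))).sub
    (S (lam σ2 + 2) (lam σ1))).add (S (lam σ2 + 2) (lam σ1 + 2))).mul_left C
  have H2 : HasSum (G ∘ ((↑) : s → ℕ × ℕ)) (C * (L4 q p (lam σ2) (lam σ1) - L4 q p (lam σ2) (lam σ1 + 2)
          - L4 q p (lam σ2 + 2) (lam σ1) + L4 q p (lam σ2 + 2) (lam σ1 + 2))) := by
    refine Eq.mp (congrArg (fun f => HasSum f _) ?_) H
    funext x
    simp only [Function.comp, G, add_mul, pow_add, aux_odd]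
    ring
  rw [hasSum_subtype_iff_indicator] at H2
  let e : ℕ × ℕ → ℕ × ℕ := fun x => (2 * x.1 + 1, 2 * x.2 + 1)
  have he : Function.Injective e := by
    rintro ⟨a, b⟩ ⟨c, d⟩ h
    simp only [e, Prod.mk.injEq] at h ⊢
    omega
  have hz : ∀ x ∉ Set.range e, s.indicator G x = 0 := by
    rintro ⟨a, b⟩ hx
    have : Even a ∨ Even b := by
      by_contra! hcon
      simp only [Nat.not_even_iff_odd] at hcon
      obtain ⟨⟨c, rfl⟩, ⟨d, rfl⟩⟩ := hcon
      exact hx ⟨(c, d), rfl⟩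
    have hG : G (a, b) = 0 := by
      rcases this with h | h <;> simp [G, h.neg_one_pow]
    simp [Set.indicator, hG]
  rw [← he.hasSum_iff hz] at H2
  have H3 : ∀ n : ℕ, HasSum (fun k : ℕ => (s.indicator G ∘ e) (n, k))
      ((σ2 ^ n * oddH n p σ1 / ((n : ℝ) + 1 / 2) ^ q : ℝ) : ℂ) := by
    intro n
    have : ((σ2 ^ n * oddH n p σ1 / ((n : ℝ) + 1 / 2) ^ q : ℝ) : ℂ)
        = ∑ k ∈ Finset.range n, (s.indicator G ∘ e) (n, k) := by
      unfold oddH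
      rw [Finset.mul_sum, Finset.sum_div]
      push_cast
      apply Finset.sum_congr rfl
      intro k hk
      have hk' : k < n := Finset.mem_range.mp hk
      have hmem : e (n, k) ∈ s := by
        simp only [e, s, Set.mem_ofPred_eq]; omega
      rw [Function.comp, Set.indicator_of_mem hmem]
      simp only [G, e, hC]
      rw [← aux_I σ1 h1 k, ← aux_I σ2 h2 n]
      have o : ∀ m : ℕ, (-1 : ℂ) ^ (2 * m + 1) = -1 := fun m => by
        rw [pow_succ, pow_mul]; simp
      rw [o, o]
      have hh : ∀ m : ℕ, ((m : ℂ) + 1 / 2) = ((2 * m + 1 : ℕ) : ℂ) / 2 := fun m => by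
        push_cast; ring
      rw [hh, hh, div_pow, div_pow]
      have nz : ∀ m : ℕ, ((2 * m + 1 : ℕ) : ℂ) ≠ 0 := fun m => Nat.cast_ne_zero.mpr (by omega)
      have n1 := nz n
      have n2 := nz k
      have ht : (2 : ℂ) ^ p * 2 ^ q = 2 ^ (p + q - 2) * 4 := by
        rw [← pow_add, show (4 : ℂ) = 2 ^ 2 by norm_num, ← pow_add]
        congr 1; omega
      generalize ((2 * n + 1 : ℕ) : ℂ) = N at *
      generalize ((2 * k + 1 : ℕ) : ℂ) = K at *
      rw [pow_add Complex.I, pow_add Complex.I]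
      generalize Complex.I ^ (3 * lam σ1) = A
      generalize Complex.I ^ (3 * lam σ2) = B
      generalize Complex.I ^ (lam σ1 * (2 * k + 1)) = A'
      generalize Complex.I ^ (lam σ2 * (2 * n + 1)) = B'
      have : B * B' * (A * A' / (K ^ p / 2 ^ p)) / (N ^ q / 2 ^ q)
          = (2 ^ p * 2 ^ q) * (A * A' * B * B') / (N ^ q * K ^ p) := by
        field_simp
      rw [this, ht]
      ring
    rw [this]
    apply hasSum_sum_of_ne_finset_zero
    intro k hk
    have : e (n, k) ∉ s := by
      simp only [e, s, Set.mem_ofPred_eq, Finset.mem_range] at hk ⊢; omega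
    simp [Set.indicator, this]
  have H4 := H2.prod_fiberwise H3
  unfold TSum
  rw [Complex.ofReal_tsum]
  exact H4.tsum_eq

theorem stmt10 (p q : ℕ) (hp : 1 ≤ p) (hq : 1 ≤ q) (σ1 σ2 : ℝ)
    (h1 : σ1 = 1 ∨ σ1 = -1) (h2 : σ2 = 1 ∨ σ2 = -1)
    (hne : ¬(q = 1 ∧ σ2 = 1)) :
    (TSum p q σ1 σ2 : ℂ) =
      2 ^ (p + q - 2) * Complex.I ^ (3 * lam σ1 + 3 * lam σ2) *
        (L4 q p (lam σ2) (lam σ1) - L4 q p (lam σ2) (lam σ1 + 2)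
          - L4 q p (lam σ2 + 2) (lam σ1) + L4 q p (lam σ2 + 2) (lam σ1 + 2)) := by
  rcases Nat.lt_or_ge 1 q with h | h
  · exact aux_main p q hp h σ1 σ2 h1 h2
  · obtain rfl : q = 1 := le_antisymm h hq
    simp [aux_L4_one, aux_TSum_one p hp σ1 σ2 h1 h2]
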